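/- Explicit bound on the determining wavenumber in the subcritical case: let 1 < α < 2, ν > 0, L > 0, c₀ > 0, R ≥ 0, and set λ_q = 2^q/L (so λ₀ = 1/L). Let (θ_p)_{p≥−1} be measurable functions on 𝕋² = (ℝ/(Lℤ))² with ‖θ_p‖_{L^∞(𝕋²)} ≤ R for all p ≥ −1. Then for every integer q ≥ −1 with λ_q ≥ max{ λ₀^{−1} (2R/(c₀(α−1)²ν))^{2/(α−1)}, (2R/(c₀(α−1)²ν))^{1/(α−1)} }, one has: (i) λ_p^{(1−α)/2} ‖θ_p‖_{L^{4/(α−1)}(𝕋²)} ≤ ½ c₀(α−1)² ν for every p > q, and (ii) λ_q^{−α} ∑_{p=−1}^{q} λ_p ‖θ_p‖_{L^∞(𝕋²)} ≤ c₀(α−1)² ν. -/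

import Mathlib

open MeasureTheory Complex Real
open scoped ENNReal

noncomputable section

/-- The dyadic wavenumber `λ_q = 2^q/L`. -/
def lamq (L : ℝ) (q : ℤ) : ℝ := 2 ^ q / L

theorem lamq_pos {L : ℝ} (hL : 0 < L) (q : ℤ) : 0 < lamq L q :=
  div_pos (zpow_pos two_pos q) hL

theorem lamq_mono {L : ℝ} (hL : 0 < L) : Monotone (lamq L) := fun _ _ h =>
  div_le_div_of_nonneg_right (zpow_le_zpow_right₀ one_le_two h) hL.le

theorem lamq_add_one (L : ℝ) (q : ℤ) : lamq L (q + 1) = 2 * lamq L q := by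
  unfold lamq
  rw [zpow_add_one₀ two_ne_zero]
  ring

theorem sum_Icc_lamq_le {L : ℝ} (hL : 0 < L) {m q : ℤ} (hq : m ≤ q) :
    ∑ p ∈ Finset.Icc m q, lamq L p ≤ 2 * lamq L q := by
  induction q, hq using Int.leInduction with
  | base =>
    rw [Finset.Icc_self, Finset.sum_singleton]
    linarith [lamq_pos hL m]
  | succ q hq ih =>
    have h : Finset.Icc m (q + 1) = insert (q + 1) (Finset.Icc m q) := by
      ext x
      simp only [Finset.mem_insert, Finset.mem_Icc]
      omega
    rw [h, Finset.sum_insert (by simp), lamq_add_one]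
    linarith

/-- On the two-dimensional torus, the `L^r` norm is at most `L^{2/r}` times the sup norm. -/
theorem eLpNorm_torus_le {L : ℝ} [hL : Fact (0 < L)] {f : AddCircle L × AddCircle L → ℝ} {R r : ℝ}
    (hR : 0 ≤ R) (hr : 0 < r) (hf : eLpNorm f ⊤ volume ≤ ENNReal.ofReal R) :
    eLpNorm f (ENNReal.ofReal r) volume ≤ ENNReal.ofReal ((L * L) ^ r⁻¹ * R) := by
  have hbound : ∀ᵐ x ∂(volume : Measure (AddCircle L × AddCircle L)), ‖f x‖ ≤ R := by
    rw [eLpNorm_exponent_top] at hf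
    filter_upwards [enorm_ae_le_eLpNormEssSup f volume] with x hx
    have := hx.trans hf
    rwa [← ofReal_norm, ENNReal.ofReal_le_ofReal_iff hR] at this
  have huniv : (volume : Measure (AddCircle L × AddCircle L)) Set.univ
      = ENNReal.ofReal (L * L) := by
    rw [Measure.volume_eq_prod, ← Set.univ_prod_univ, Measure.prod_prod, AddCircle.measure_univ,
      ENNReal.ofReal_mul hL.out.le]
  refine (eLpNorm_le_of_ae_bound hbound).trans_eq ?_
  rw [huniv, ENNReal.toReal_ofReal hr.le,
    ENNReal.ofReal_rpow_of_nonneg (mul_self_nonneg L) (inv_nonneg.2 hr.le),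
    ← ENNReal.ofReal_mul (Real.rpow_nonneg (mul_self_nonneg L) _)]

/-- **Explicit bound on the determining wavenumber in the subcritical case.**
Let `1 < α < 2`, `ν > 0`, `L > 0`, `c₀ > 0`, `R ≥ 0`, and let `(θ_p)_{p≥−1}` satisfy
`‖θ_p‖_{L^∞(𝕋²)} ≤ R`.  Then for every `q ≥ −1` with
`λ_q ≥ max{ λ₀⁻¹ (2R/(c₀(α−1)²ν))^{2/(α−1)}, (2R/(c₀(α−1)²ν))^{1/(α−1)} }` (here `λ₀ = 1/L`):
(i) `λ_p^{(1−α)/2} ‖θ_p‖_{L^{4/(α−1)}} ≤ ½ c₀(α−1)²ν` for every `p > q`, and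
(ii) `λ_q^{−α} ∑_{p=−1}^{q} λ_p ‖θ_p‖_{L^∞} ≤ c₀(α−1)²ν`. -/
theorem subcritical_wavenumber_bound (α ν c₀ R : ℝ) (L : ℝ) [Fact (0 < L)]
    (hα1 : 1 < α) (hα2 : α < 2) (hν : 0 < ν) (hc₀ : 0 < c₀) (hR : 0 ≤ R)
    (θ : ℤ → AddCircle L × AddCircle L → ℝ)
    (hθ : ∀ p : ℤ, -1 ≤ p → eLpNorm (θ p) ⊤ volume ≤ ENNReal.ofReal R)
    (q : ℤ) (hq : -1 ≤ q)
    (hlam : max (L * (2 * R / (c₀ * (α - 1) ^ 2 * ν)) ^ (2 / (α - 1)))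
        ((2 * R / (c₀ * (α - 1) ^ 2 * ν)) ^ (1 / (α - 1))) ≤ lamq L q) :
    (∀ p : ℤ, q < p →
        ENNReal.ofReal (lamq L p ^ ((1 - α) / 2)) *
            eLpNorm (θ p) (ENNReal.ofReal (4 / (α - 1))) volume
          ≤ ENNReal.ofReal (c₀ * (α - 1) ^ 2 * ν / 2)) ∧
      ENNReal.ofReal (lamq L q ^ (-α)) *
          ∑ p ∈ Finset.Icc (-1 : ℤ) q, ENNReal.ofReal (lamq L p) * eLpNorm (θ p) ⊤ volume
        ≤ ENNReal.ofReal (c₀ * (α - 1) ^ 2 * ν) := by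
  have hL : 0 < L := Fact.out
  have hs : 0 < α - 1 := sub_pos.2 hα1
  have hK : 0 < c₀ * (α - 1) ^ 2 * ν := by positivity
  set K := c₀ * (α - 1) ^ 2 * ν
  have hM : 0 ≤ 2 * R / K := by positivity
  have hRM : R = 2 * R / K * K / 2 := by field_simp
  set M := 2 * R / K
  have hlam₁ := (le_max_left _ _).trans hlam
  have hlam₂ := (le_max_right _ _).trans hlam
  constructor
  · intro p hp
    have hlp := lamq_pos hL p
    refine (mul_le_mul_right (eLpNorm_torus_le hR (by positivity) (hθ p (by omega))) _).trans ?_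
    rw [← ENNReal.ofReal_mul (by positivity)]
    refine ENNReal.ofReal_le_ofReal ?_
    have h : L ^ ((α - 1) / 2) * M ≤ lamq L p ^ ((α - 1) / 2) := by
      have h₁ := Real.rpow_le_rpow (by positivity) (hlam₁.trans (lamq_mono hL hp.le))
        (show 0 ≤ (α - 1) / 2 by positivity)
      rwa [Real.mul_rpow hL.le (by positivity), ← Real.rpow_mul hM,
        show 2 / (α - 1) * ((α - 1) / 2) = 1 by field_simp, Real.rpow_one] at h₁
    have hLL : (L * L) ^ (4 / (α - 1))⁻¹ = L ^ ((α - 1) / 2) := by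
      rw [Real.mul_rpow hL.le hL.le, ← Real.rpow_add hL]
      congr 1
      field_simp
      norm_num
    have hcancel : lamq L p ^ ((1 - α) / 2) * lamq L p ^ ((α - 1) / 2) = 1 := by
      rw [← Real.rpow_add hlp, show (1 - α) / 2 + (α - 1) / 2 = 0 by ring, Real.rpow_zero]
    calc lamq L p ^ ((1 - α) / 2) * ((L * L) ^ (4 / (α - 1))⁻¹ * R)
        = lamq L p ^ ((1 - α) / 2) * (L ^ ((α - 1) / 2) * M) * (K / 2) := by
          rw [hLL]
          nth_rewrite 1 [hRM]
          ring
      _ ≤ lamq L p ^ ((1 - α) / 2) * lamq L p ^ ((α - 1) / 2) * (K / 2) := by gcongr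
      _ = K / 2 := by rw [hcancel, one_mul]
  · have hlq := lamq_pos hL q
    have hsum : ∑ p ∈ Finset.Icc (-1 : ℤ) q, ENNReal.ofReal (lamq L p) * eLpNorm (θ p) ⊤ volume
        ≤ ENNReal.ofReal (2 * lamq L q * R) := by
      calc _ ≤ ∑ p ∈ Finset.Icc (-1 : ℤ) q, ENNReal.ofReal (lamq L p) * ENNReal.ofReal R := by
            refine Finset.sum_le_sum fun p hp => ?_
            gcongr
            exact hθ p (Finset.mem_Icc.1 hp).1
        _ = ENNReal.ofReal ((∑ p ∈ Finset.Icc (-1 : ℤ) q, lamq L p) * R) := by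
            rw [← Finset.sum_mul, ← ENNReal.ofReal_sum_of_nonneg fun p _ => (lamq_pos hL p).le,
              ← ENNReal.ofReal_mul (Finset.sum_nonneg fun p _ => (lamq_pos hL p).le)]
        _ ≤ _ := by
            gcongr
            exact sum_Icc_lamq_le hL hq
    refine (mul_le_mul_right hsum _).trans ?_
    rw [← ENNReal.ofReal_mul (by positivity)]
    refine ENNReal.ofReal_le_ofReal ?_
    have h : M ≤ lamq L q ^ (α - 1) := by
      have h₁ := Real.rpow_le_rpow (by positivity) hlam₂ hs.le
      rwa [← Real.rpow_mul hM, one_div_mul_cancel hs.ne', Real.rpow_one] at h₁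
    have hcancel : lamq L q ^ (-α) * lamq L q * lamq L q ^ (α - 1) = 1 := by
      rw [← Real.rpow_add_one hlq.ne', ← Real.rpow_add hlq,
        show -α + 1 + (α - 1) = 0 by ring, Real.rpow_zero]
    calc lamq L q ^ (-α) * (2 * lamq L q * R)
        = lamq L q ^ (-α) * lamq L q * M * K := by
          nth_rewrite 1 [hRM]
          ring
      _ ≤ lamq L q ^ (-α) * lamq L q * lamq L q ^ (α - 1) * K := by gcongr
      _ = K := by rw [hcancel, one_mul]
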